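/- Let K be a normed field, let n ≥ 2 be a natural number, and let a, b, c ∈ K with b ≠ 0. If the series ∑_{m≥0} A_m(n,1)·(a^{n−1}·c/bⁿ)ᵐ converges unconditionally to β ∈ K (HasSum, with the integers A_m(n,1) = binom(mn,m)/((n−1)m+1) cast into K), then α := a·β/b satisfies a − b·α + c·αⁿ = 0. -/

import Mathlib

/-- The Fuss–Catalan number `A_m(n,1) = binom(mn,m)/((n-1)m+1)` (the division is exact). -/
def fussCatalan (n m : ℕ) : ℕ := (m * n).choose m / ((n - 1) * m + 1)

/-- The two-parameter Fuss–Catalan numbers (Raney numbers) `A_m(n,r)`, defined by the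
recurrence `A_{m+1}(n,r+1) = A_{m+1}(n,r) + A_m(n,r+n)`. -/
def raney (n : ℕ) : ℕ → ℕ → ℕ
  | 0, _ => 1
  | _ + 1, 0 => 0
  | m + 1, r + 1 => raney n (m + 1) r + raney n m (r + n)

theorem mul_add_mul_raney (n : ℕ) (hn : 0 < n) (m r : ℕ) :
    (m * n + r) * raney n m r = r * (m * n + r).choose m := by
  induction m generalizing r with
  | zero => simp [raney]
  | succ m ihm =>
    induction r with
    | zero => simp [raney]
    | succ r ihr =>
      have h₁ := ihm (r + n)
      obtain ⟨M, hM⟩ : ∃ M, (m + 1) * n + r = M := ⟨_, rfl⟩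
      have hM' : m * n + (r + n) = M := by rw [← hM]; ring
      have hpos : 0 < M := by rw [← hM]; positivity
      rw [hM] at ihr
      rw [hM'] at h₁
      rw [← add_assoc, hM, raney]
      have h₂ := Nat.add_one_mul_choose_eq M m
      have h₃ := Nat.choose_succ_succ' M m
      apply Nat.eq_of_mul_eq_mul_left hpos
      apply Nat.eq_of_mul_eq_mul_left (Nat.succ_pos m)
      zify at *
      linear_combination (m + 1 : ℤ) * (M + 1) * ihr + (m + 1 : ℤ) * (M + 1) * h₁
        - (M + 1 : ℤ) * (m + 1) * r * h₃ + (M + 1 : ℤ) * M.choose m * hM + (M - r : ℤ) * h₂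

theorem fussCatalan_eq_raney (n : ℕ) (hn : 0 < n) (m : ℕ) :
    fussCatalan n m = raney n m 1 := by
  obtain ⟨k, rfl⟩ : ∃ k, n = k + 1 := ⟨n - 1, by omega⟩
  have h₁ := mul_add_mul_raney (k + 1) hn m 1
  have h₃ := Nat.choose_mul_succ_eq (m * (k + 1)) m
  have h₄ : m * (k + 1) + 1 - m = k * m + 1 := by
    have : m * (k + 1) = k * m + m := by ring
    omega
  rw [h₄] at h₃
  rw [fussCatalan, Nat.add_sub_cancel]
  apply Nat.div_eq_of_eq_mul_left (Nat.succ_pos _)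
  apply Nat.eq_of_mul_eq_mul_left (Nat.succ_pos (m * (k + 1)))
  simp only [Nat.succ_eq_add_one]
  linarith [congrArg (· * (k * m + 1)) h₁]

open PowerSeries in
/-- The generating series of `m ↦ A_m(n,r)`, the `r`-th power of the generalized binomial
series. -/
noncomputable def raneySeries (n r : ℕ) : ℕ⟦X⟧ := PowerSeries.mk fun m => raney n m r

theorem raneySeries_zero (n : ℕ) : raneySeries n 0 = 1 := by
  ext m
  cases m <;> simp [raneySeries, raney, PowerSeries.coeff_one]

theorem raneySeries_succ (n r : ℕ) :
    raneySeries n (r + 1) = raneySeries n r + PowerSeries.X * raneySeries n (r + n) := by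
  ext m
  cases m <;> simp [raneySeries, raney, PowerSeries.coeff_succ_X_mul]

theorem raneySeries_add (n r s : ℕ) :
    raneySeries n (r + s) = raneySeries n r * raneySeries n s := by
  ext m
  induction m generalizing r with
  | zero => simp [raneySeries, raney]
  | succ m ihm =>
    induction r with
    | zero => simp [raneySeries_zero]
    | succ r ihr =>
      rw [show r + 1 + s = r + s + 1 by ring, raneySeries_succ, raneySeries_succ n r, add_mul,
        map_add, map_add, ihr, mul_assoc, PowerSeries.coeff_succ_X_mul,
        PowerSeries.coeff_succ_X_mul, show r + s + n = r + n + s by ring, ihm]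

theorem raneySeries_one_pow (n r : ℕ) : raneySeries n 1 ^ r = raneySeries n r := by
  induction r with
  | zero => rw [pow_zero, raneySeries_zero]
  | succ r ih => rw [pow_succ, ih, raneySeries_add]

theorem raneySeries_one_eq (n : ℕ) :
    raneySeries n 1 = 1 + PowerSeries.X * raneySeries n 1 ^ n := by
  have h := raneySeries_succ n 0
  rwa [raneySeries_zero, zero_add, zero_add, ← raneySeries_one_pow n n] at h

section FunctionalEquation

open PowerSeries

variable {n : ℕ} {F : ℕ⟦X⟧}

theorem coeff_zero_of_eq_one_add_X_mul_pow (hF : F = 1 + X * F ^ n) : coeff 0 F = 1 := by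
  rw [hF]
  simp

theorem coeff_succ_of_eq_one_add_X_mul_pow (hF : F = 1 + X * F ^ n) (m : ℕ) :
    coeff (m + 1) F = coeff m (F ^ n) := by
  conv_lhs => rw [hF]
  simp [coeff_one, coeff_succ_X_mul]

end FunctionalEquation

section Nonarchimedean

open PowerSeries Finset

theorem hasSum_coeff_mul_of_nonarchimedean {K : Type*} [NormedField K] [IsUltrametricDist K]
    {F G : ℕ⟦X⟧} {z u v : K}
    (hF : HasSum (fun m => ((coeff m F : ℕ) : K) * z ^ m) u)
    (hG : HasSum (fun m => ((coeff m G : ℕ) : K) * z ^ m) v) :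
    HasSum (fun m => ((coeff m (F * G) : ℕ) : K) * z ^ m) (u * v) := by
  have : NonarchimedeanRing K := { is_nonarchimedean := NonarchimedeanAddGroup.is_nonarchimedean }
  have h := hF.mul_of_nonarchimedean hG
  rw [← HasAntidiagonal.sigmaAntidiagonalEquivProd.hasSum_iff] at h
  convert h.sigma fun m => hasSum_fintype _ using 2 with m
  rw [coeff_mul, Nat.cast_sum, sum_mul, ← sum_coe_sort]
  refine sum_congr rfl fun p _ => ?_
  have hp := mem_antidiagonal.mp p.2
  simp only [Function.comp_apply, HasAntidiagonal.sigmaAntidiagonalEquivProd_apply]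
  have hz : z ^ m = z ^ (p : ℕ × ℕ).1 * z ^ (p : ℕ × ℕ).2 := by rw [← pow_add, hp]
  rw [hz]
  push_cast
  ring

theorem hasSum_coeff_pow_of_nonarchimedean {K : Type*} [NormedField K] [IsUltrametricDist K]
    {F : ℕ⟦X⟧} {z u : K} (hF : HasSum (fun m => ((coeff m F : ℕ) : K) * z ^ m) u) (j : ℕ) :
    HasSum (fun m => ((coeff m (F ^ j) : ℕ) : K) * z ^ m) (u ^ j) := by
  induction j with
  | zero =>
    simp only [pow_zero]
    convert hasSum_single (f := fun m => ((coeff m (1 : ℕ⟦X⟧) : ℕ) : K) * z ^ m) 0 ?_ using 1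
    · simp
    · intro m hm
      simp [coeff_one, hm]
  | succ j ih =>
    simp only [pow_succ]
    exact hasSum_coeff_mul_of_nonarchimedean ih hF

/-- Over an ultrametric field, a power series solution of `F = 1 + X * F ^ n` may be evaluated at
every point where it converges. -/
theorem eq_one_add_mul_pow_of_nonarchimedean {K : Type*} [NormedField K] [IsUltrametricDist K]
    {n : ℕ} {F : ℕ⟦X⟧} (hF : F = 1 + X * F ^ n) {z β : K}
    (hβ : HasSum (fun m => ((coeff m F : ℕ) : K) * z ^ m) β) :
    β = 1 + z * β ^ n := by
  have h := (hasSum_coeff_pow_of_nonarchimedean hβ n).mul_left z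
  have h₂ := (hasSum_nat_add_iff' 1).mpr hβ
  simp only [coeff_succ_of_eq_one_add_X_mul_pow hF, sum_range_one,
    coeff_zero_of_eq_one_add_X_mul_pow hF] at h₂
  have h₃ := h₂.unique (by simpa only [pow_succ', mul_left_comm] using h)
  rw [Nat.cast_one, pow_zero] at h₃
  linear_combination h₃

end Nonarchimedean

section Archimedean

open Finset

theorem norm_sum_natCast_mul_le_of_le {ι K : Type*} [NormedField K] {x : ι → K} {s : Finset ι}
    {ε : ℝ} (hx : ∀ t ⊆ s, ‖∑ i ∈ t, x i‖ ≤ ε) (k : ℕ) (d : ι → ℕ) (hd : ∀ i ∈ s, d i ≤ k) :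
    ‖∑ i ∈ s, (d i : K) * x i‖ ≤ k * ε := by
  have h : ∑ i ∈ s, (d i : K) * x i = ∑ j ∈ range k, ∑ i ∈ s with j < d i, x i := by
    simp_rw [sum_filter]
    rw [sum_comm]
    refine sum_congr rfl fun i hi => ?_
    rw [← sum_filter, sum_const, nsmul_eq_mul]
    congr
    have : (range k).filter (fun j => j < d i) = range (d i) := by
      ext j
      have := hd i hi
      simp only [mem_filter, mem_range]
      omega
    rw [this, card_range]
  rw [h]
  refine (norm_sum_le_of_le _ fun j _ => hx _ (filter_subset _ _)).trans ?_
  simp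

/-- If some natural number `k` has norm greater than `1`, then shrinking the natural number
coefficients of a finite sum increases the supremum of the norms of its subsums by at most a
constant factor. -/
theorem norm_sum_natCast_mul_le {ι K : Type*} [NormedField K] {k : ℕ} (hk : 1 < ‖(k : K)‖)
    {A : ι → ℕ} {y : ι → K} {s : Finset ι} {ε : ℝ}
    (hx : ∀ t ⊆ s, ‖∑ i ∈ t, (A i : K) * y i‖ ≤ ε) (D : ι → ℕ) (hD : ∀ i ∈ s, D i ≤ A i) :
    ‖∑ i ∈ s, (D i : K) * y i‖ ≤ k * ε / (‖(k : K)‖ - 1) := by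
  set W : Set ℝ := {r | ∃ D : ι → ℕ, (∀ i ∈ s, D i ≤ A i) ∧ ‖∑ i ∈ s, (D i : K) * y i‖ = r}
  have hbdd : BddAbove W := by
    refine ⟨∑ i ∈ s, (A i : ℝ) * ‖y i‖, ?_⟩
    rintro _ ⟨D, hD, rfl⟩
    refine norm_sum_le_of_le _ fun i hi => ?_
    rw [norm_mul]
    gcongr
    calc ‖(D i : K)‖ ≤ D i := by simpa using Nat.norm_cast_le (α := K) (D i)
      _ ≤ A i := by exact_mod_cast hD i hi
  have hk₀ : 0 < ‖(k : K)‖ := zero_lt_one.trans hk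
  have hstep : sSup W ≤ (k * ε + sSup W) / ‖(k : K)‖ := by
    refine csSup_le ⟨_, D, hD, rfl⟩ ?_
    rintro _ ⟨D, hD, rfl⟩
    rw [le_div_iff₀' hk₀, ← norm_mul]
    have hsplit : (k : K) * ∑ i ∈ s, (D i : K) * y i =
        ∑ i ∈ s, ((k * D i / A i : ℕ) : K) * ((A i : K) * y i) +
          ∑ i ∈ s, ((k * D i % A i : ℕ) : K) * y i := by
      rw [mul_sum, ← sum_add_distrib]
      refine sum_congr rfl fun i _ => ?_
      have h : ((A i * (k * D i / A i) + k * D i % A i : ℕ) : K) = ((k * D i : ℕ) : K) := by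
        rw [Nat.div_add_mod]
      push_cast at h
      linear_combination -y i * h
    rw [hsplit]
    refine (norm_add_le _ _).trans (add_le_add ?_ (le_csSup hbdd ⟨_, fun i hi => ?_, rfl⟩))
    · refine norm_sum_natCast_mul_le_of_le hx k _ fun i hi => ?_
      exact Nat.div_le_of_le_mul (by nlinarith [hD i hi])
    · rcases Nat.eq_zero_or_pos (A i) with h | h
      · have := hD i hi
        simp_all
      · exact (Nat.mod_lt _ h).le
  refine (le_csSup hbdd ⟨D, hD, rfl⟩).trans ?_
  rw [le_div_iff₀ (by linarith)]
  rw [le_div_iff₀ hk₀] at hstep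
  linarith

open PowerSeries in
theorem coeff_trunc_pow_le (F : ℕ⟦X⟧) (N n m : ℕ) :
    (trunc N F ^ n).coeff m ≤ coeff m (F ^ n) := by
  induction n generalizing m with
  | zero => simp [Polynomial.coeff_one, PowerSeries.coeff_one]
  | succ n ih =>
    rw [pow_succ, pow_succ, Polynomial.coeff_mul, PowerSeries.coeff_mul]
    refine sum_le_sum fun p _ => Nat.mul_le_mul (ih _) ?_
    rw [coeff_trunc]
    split_ifs <;> simp

open PowerSeries Filter Topology in
/-- Over a field whose norm is unbounded on the natural numbers, a power series solution of
`F = 1 + X * F ^ n` with natural number coefficients may be evaluated at every point where it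
converges unconditionally. -/
theorem eq_one_add_mul_pow_of_one_lt_norm {K : Type*} [NormedField K] {k : ℕ}
    (hk : 1 < ‖(k : K)‖) {n : ℕ} {F : ℕ⟦X⟧} (hF : F = 1 + X * F ^ n) {z β : K}
    (hβ : HasSum (fun m => ((coeff m F : ℕ) : K) * z ^ m) β) :
    β = 1 + z * β ^ n := by
  obtain ⟨p, hp⟩ : ∃ p : ℕ → K, p = fun N => ∑ m ∈ range N, ((coeff m F : ℕ) : K) * z ^ m :=
    ⟨_, rfl⟩
  have hlim : Tendsto p atTop (𝓝 β) := hp ▸ hβ.tendsto_sum_nat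
  have hlim' : Tendsto (fun N => 1 + z * p N ^ n - p N) atTop (𝓝 (1 + z * β ^ n - β)) :=
    (((hlim.pow n).const_mul z).const_add 1).sub hlim
  suffices h : Tendsto (fun N => 1 + z * p N ^ n - p N) atTop (𝓝 0) by
    have := tendsto_nhds_unique hlim' h
    linear_combination -this
  have hcauchy : CauchySeq fun s : Finset ℕ => ∑ m ∈ s, ((coeff m F : ℕ) : K) * z ^ m := by
    refine Tendsto.cauchySeq (x := β) ?_
    simpa only [HasSum, SummationFilter.unconditional_filter] using hβ
  rw [NormedAddGroup.tendsto_nhds_zero]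
  intro ε hε
  have hc : 0 < ‖(k : K)‖ - 1 := by linarith
  have hk₁ : (0 : ℝ) < k := by
    rcases Nat.eq_zero_or_pos k with rfl | h
    · simp at hk
      linarith
    · exact_mod_cast h
  obtain ⟨s, hs⟩ := cauchySeq_finset_iff_vanishing_norm.mp hcauchy
    (ε * (‖(k : K)‖ - 1) / (2 * k)) (by positivity)
  obtain ⟨N₀, hN₀⟩ := s.exists_nat_subset_range
  filter_upwards [eventually_ge_atTop N₀] with N hN
  obtain ⟨P, hP⟩ : ∃ P : Polynomial ℕ, P = 1 + Polynomial.X * trunc N F ^ n := ⟨_, rfl⟩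
  have hP₀ : P.coeff 0 = coeff 0 F := by
    rw [coeff_zero_of_eq_one_add_X_mul_pow hF]
    simp [hP]
  have hP₁ : ∀ m, P.coeff (m + 1) = (trunc N F ^ n).coeff m := fun m => by
    simp [hP, Polynomial.coeff_one]
  have hcoeff : ∀ m, P.coeff m ≤ coeff m F := fun m => by
    cases m with
    | zero => exact hP₀.le
    | succ m =>
      rw [hP₁, coeff_succ_of_eq_one_add_X_mul_pow hF]
      exact coeff_trunc_pow_le F N n m
  have hcoeff_eq : ∀ m < N, P.coeff m = coeff m F := fun m hm => by
    cases m with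
    | zero => exact hP₀
    | succ m =>
      rw [hP₁, coeff_succ_of_eq_one_add_X_mul_pow hF]
      have h := congrArg (Polynomial.coeff · m) (trunc_trunc_pow F N n)
      simp only [coeff_trunc, if_pos (show m < N by omega)] at h
      rwa [← Polynomial.coe_pow, Polynomial.coeff_coe] at h
  have heval : P.eval₂ (Nat.castRingHom K) z = 1 + z * p N ^ n := by
    simp [hP, Polynomial.eval₂_add, Polynomial.eval₂_mul, Polynomial.eval₂_pow,
      eval₂_trunc_eq_sum_range, hp]
  obtain ⟨M, hM⟩ : ∃ M, M = N + P.natDegree + 1 := ⟨_, rfl⟩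
  have hsum : 1 + z * p N ^ n - p N = ∑ m ∈ Ico N M, (P.coeff m : K) * z ^ m := by
    rw [← heval, Polynomial.eval₂_eq_sum_range' _ (show P.natDegree < M by omega),
      ← sum_range_add_sum_Ico _ (show N ≤ M by omega), hp]
    simp only [Nat.coe_castRingHom]
    rw [sum_congr rfl fun m hm => by rw [hcoeff_eq m (mem_range.mp hm)]]
    ring
  rw [hsum]
  refine (norm_sum_natCast_mul_le hk (fun t ht => (hs t ?_).le) _ fun m _ => hcoeff m).trans_lt ?_
  · refine disjoint_left.mpr fun m hm hms => ?_
    have h₁ := mem_Ico.mp (ht hm)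
    have h₂ := mem_range.mp (hN₀ hms)
    omega
  · have : k * (ε * (‖(k : K)‖ - 1) / (2 * k)) / (‖(k : K)‖ - 1) = ε / 2 := by
      field_simp
    linarith

end Archimedean

theorem trinomial_root
    {K : Type*} [NormedField K] (n : ℕ) (hn : 2 ≤ n)
    (a b c : K) (hb : b ≠ 0) (β : K)
    (hβ : HasSum (fun m : ℕ => (fussCatalan n m : K) * (a ^ (n - 1) * c / b ^ n) ^ m) β)
    (α : K) (hα : α = a * β / b) :
    a - b * α + c * α ^ n = 0 := by
  have hβ' : HasSum (fun m => ((PowerSeries.coeff m (raneySeries n 1) : ℕ) : K) *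
      (a ^ (n - 1) * c / b ^ n) ^ m) β := by
    simpa [raneySeries, fussCatalan_eq_raney n (by omega)] using hβ
  have key : β = 1 + a ^ (n - 1) * c / b ^ n * β ^ n := by
    by_cases h : ∀ k : ℕ, ‖(k : K)‖ ≤ 1
    · have := IsUltrametricDist.isUltrametricDist_of_forall_norm_natCast_le_one h
      exact eq_one_add_mul_pow_of_nonarchimedean (raneySeries_one_eq n) hβ'
    · push Not at h
      obtain ⟨k, hk⟩ := h
      exact eq_one_add_mul_pow_of_one_lt_norm hk (raneySeries_one_eq n) hβ'
  have hroot : c * α ^ n = a * (a ^ (n - 1) * c / b ^ n * β ^ n) := by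
    rw [hα, div_pow, mul_pow, ← mul_pow_sub_one (show n ≠ 0 by omega) a]
    ring
  have hlin : b * α = a * β := by
    rw [hα]
    field_simp
  rw [hroot, hlin]
  linear_combination -a * key
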